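/- arXiv:math/0308125 — 5 statements merged into one kernel-verified Lean document; each statement's English description precedes it below -/
import Mathlib

section
/- The group Γ⁵ of integral, positive, Lorentzian 6×6 matrices is generated by the following six matrices: the 6×6 permutation matrices of the coordinate transpositions (1 2), (2 3), (3 4) and (4 5); the matrix V which equals the 6×6 identity matrix except that its upper-left 3×3 block is [[0,−1,−1],[−1,0,−1],[−1,−1,0]], its entries (1,6), (2,6), (3,6) equal 1, its entries (6,1), (6,2), (6,3) equal −1, and its entry (6,6) equals 2; and the diagonal matrix D = diag(1,1,1,1,−1,1). -/
open Matrix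

/-- The matrix `J = diag(1,1,1,1,1,-1)` of the Lorentzian quadratic form. -/
def lorJ : Matrix (Fin 6) (Fin 6) ℤ := Matrix.diagonal ![1, 1, 1, 1, 1, -1]

/-- A real (here integral) 6×6 matrix is Lorentzian if `Aᵀ J A = J`. -/
def IsLorentzian (A : Matrix (Fin 6) (Fin 6) ℤ) : Prop := Aᵀ * lorJ * A = lorJ

/-- A Lorentzian matrix is positive if its (6,6) entry is positive. -/
def IsPosLorentzian (A : Matrix (Fin 6) (Fin 6) ℤ) : Prop := IsLorentzian A ∧ 0 < A 5 5

/-- Permutation matrix of the transposition (1 2). -/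
def P12 : Matrix (Fin 6) (Fin 6) ℤ :=
  !![0,1,0,0,0,0; 1,0,0,0,0,0; 0,0,1,0,0,0; 0,0,0,1,0,0; 0,0,0,0,1,0; 0,0,0,0,0,1]

/-- Permutation matrix of the transposition (2 3). -/
def P23 : Matrix (Fin 6) (Fin 6) ℤ :=
  !![1,0,0,0,0,0; 0,0,1,0,0,0; 0,1,0,0,0,0; 0,0,0,1,0,0; 0,0,0,0,1,0; 0,0,0,0,0,1]

/-- Permutation matrix of the transposition (3 4). -/
def P34 : Matrix (Fin 6) (Fin 6) ℤ :=
  !![1,0,0,0,0,0; 0,1,0,0,0,0; 0,0,0,1,0,0; 0,0,1,0,0,0; 0,0,0,0,1,0; 0,0,0,0,0,1]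

/-- Permutation matrix of the transposition (4 5). -/
def P45 : Matrix (Fin 6) (Fin 6) ℤ :=
  !![1,0,0,0,0,0; 0,1,0,0,0,0; 0,0,1,0,0,0; 0,0,0,0,1,0; 0,0,0,1,0,0; 0,0,0,0,0,1]

/-- The matrix `V`, the reflection in the fourth side of the simplex `Δ⁵`. -/
def Vmat : Matrix (Fin 6) (Fin 6) ℤ :=
  !![0,-1,-1,0,0,1; -1,0,-1,0,0,1; -1,-1,0,0,0,1;
     0,0,0,1,0,0; 0,0,0,0,1,0; -1,-1,-1,0,0,2]

/-- The diagonal matrix `D = diag(1,1,1,1,-1,1)`. -/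
def Dmat : Matrix (Fin 6) (Fin 6) ℤ := Matrix.diagonal ![1, 1, 1, 1, -1, 1]

/-- The six generating matrices, as a family. -/
def genMat : Fin 6 → Matrix (Fin 6) (Fin 6) ℤ := ![P12, P23, P34, P45, Vmat, Dmat]

theorem genMat_mul_self (k : Fin 6) : genMat k * genMat k = 1 := by
  revert k; decide +kernel

/-- The six generators as elements of `GL₆(ℤ)`; each of them is an involution. -/
def gen (k : Fin 6) : GL (Fin 6) ℤ :=
  ⟨genMat k, genMat k, genMat_mul_self k, genMat_mul_self k⟩

theorem isPosLorentzian_gen (k : Fin 6) :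
    IsPosLorentzian (gen k : Matrix (Fin 6) (Fin 6) ℤ) := by
  change (genMat k)ᵀ * lorJ * genMat k = lorJ ∧ 0 < genMat k 5 5
  revert k; decide +kernel

/-- A linear functional that is positive on the positive light cone and decreases under every
generator whose wall separates its argument from the fundamental chamber. -/
def height (y : Fin 6 → ℤ) : ℤ := 15 * y 5 - 5 * y 0 - 4 * y 1 - 3 * y 2 - 2 * y 3 - y 4

/-- The Lorentzian quadratic form. -/
def lorSq (y : Fin 6 → ℤ) : ℤ := y 0 ^ 2 + y 1 ^ 2 + y 2 ^ 2 + y 3 ^ 2 + y 4 ^ 2 - y 5 ^ 2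

theorem lorSq_eq_dotProduct (y : Fin 6 → ℤ) : lorSq y = y ⬝ᵥ lorJ *ᵥ y := by
  simp [lorSq, lorJ, dotProduct, mulVec_diagonal, Fin.sum_univ_six]
  ring

theorem IsLorentzian.lorSq_mulVec {A : Matrix (Fin 6) (Fin 6) ℤ} (hA : IsLorentzian A)
    (y : Fin 6 → ℤ) : lorSq (A *ᵥ y) = lorSq y := by
  rw [lorSq_eq_dotProduct, lorSq_eq_dotProduct]
  nth_rewrite 1 [← vecMul_transpose]
  rw [← dotProduct_mulVec, mulVec_mulVec, mulVec_mulVec, hA]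

theorem IsLorentzian.mul_lorJ_mul_transpose {A : Matrix (Fin 6) (Fin 6) ℤ}
    (hA : IsLorentzian A) : A * lorJ * Aᵀ = lorJ := by
  have hJ : lorJ * lorJ = 1 := by decide +kernel
  have h : lorJ * Aᵀ * lorJ * A = 1 := by
    rw [← hJ, Matrix.mul_assoc lorJ, Matrix.mul_assoc lorJ, hA]
  have h' := mul_eq_one_comm.mp h
  calc A * lorJ * Aᵀ = A * (lorJ * Aᵀ * lorJ) * lorJ := by
        simp only [Matrix.mul_assoc, hJ, Matrix.mul_one]
    _ = lorJ := by rw [h', Matrix.one_mul]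

/-- Rows of a Lorentzian matrix are orthonormal for the Lorentzian form. -/
theorem IsLorentzian.row_product {A : Matrix (Fin 6) (Fin 6) ℤ} (hA : IsLorentzian A)
    (i j : Fin 6) : A i 0 * A j 0 + A i 1 * A j 1 + A i 2 * A j 2 + A i 3 * A j 3
      + A i 4 * A j 4 - A i 5 * A j 5 = lorJ i j := by
  rw [← hA.mul_lorJ_mul_transpose]
  simp [Matrix.mul_apply, lorJ, Fin.sum_univ_six, diagonal_apply]
  ring

theorem height_pos {y : Fin 6 → ℤ} (hy : lorSq y < 0) (h5 : 0 < y 5) : 0 < height y := by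
  have bound (a : ℤ) (ha : a ^ 2 < y 5 ^ 2) : a < y 5 := lt_of_pow_lt_pow_left₀ 2 h5.le ha
  unfold lorSq at hy
  have h0 := bound (y 0) (by nlinarith)
  have h1 := bound (y 1) (by nlinarith)
  have h2 := bound (y 2) (by nlinarith)
  have h3 := bound (y 3) (by nlinarith)
  have h4 := bound (y 4) (by nlinarith)
  unfold height
  linarith

/-- A vector is either lowered by a generator fixing the last coordinate or lies in the
fundamental chamber of the signed permutation group. -/
theorem exists_height_lt_or_sorted (y : Fin 6 → ℤ) :
    (∃ k, k ≠ 4 ∧ height (genMat k *ᵥ y) < height y) ∨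
      (y 1 ≤ y 0 ∧ y 2 ≤ y 1 ∧ y 3 ≤ y 2 ∧ y 4 ≤ y 3 ∧ 0 ≤ y 4) := by
  by_contra! h
  obtain ⟨hk, hs⟩ := h
  have h0 := hk 0 (by decide)
  have h1 := hk 1 (by decide)
  have h2 := hk 2 (by decide)
  have h3 := hk 3 (by decide)
  have h5 := hk 5 (by decide)
  simp [height, genMat, P12, P23, P34, P45, Dmat, mulVec, dotProduct, Fin.sum_univ_six,
    diagonal_apply] at h0 h1 h2 h3 h5
  have := hs (by linarith) (by linarith) (by linarith) (by linarith)
  linarith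

/-- In the chamber of the signed permutation group, the reflection `V` lowers every integral point
of hyperbolic space other than the base point. -/
theorem height_Vmat_lt {y : Fin 6 → ℤ} (hy : lorSq y = -1) (h5 : 1 < y 5)
    (h01 : y 1 ≤ y 0) (h12 : y 2 ≤ y 1) (h23 : y 3 ≤ y 2) (h34 : y 4 ≤ y 3) (h4 : 0 ≤ y 4) :
    height (Vmat *ᵥ y) < height y := by
  suffices h : y 5 < y 0 + y 1 + y 2 by
    simp [height, Vmat, mulVec, dotProduct, Fin.sum_univ_six]
    linarith
  unfold lorSq at hy
  refine lt_of_pow_lt_pow_left₀ 2 (by linarith) ?_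
  have key : 1 + y 3 ^ 2 + y 4 ^ 2 < 2 * (y 0 * y 1 + y 0 * y 2 + y 1 * y 2) := by
    rcases (show 0 ≤ y 2 by linarith).eq_or_lt with h2 | h2
    · have e3 : y 3 = 0 := by linarith
      have e4 : y 4 = 0 := by linarith
      rcases (show 0 ≤ y 1 by linarith).eq_or_lt with h1 | h1
      · have hlt : y 0 < y 5 := lt_of_pow_lt_pow_left₀ 2 (by linarith) (by nlinarith)
        rw [← h1, ← h2, e3, e4] at hy
        nlinarith
      · rw [← h2, e3, e4]
        nlinarith
    · nlinarith [mul_le_mul h01 h12 (by linarith) (by linarith),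
        mul_le_mul h12 h12 (by linarith) (by linarith), pow_le_pow_left₀ h4 h34 2,
        pow_le_pow_left₀ (h4.trans h34) h23 2,
        mul_le_mul (h12.trans h01) le_rfl h2.le (by linarith)]
  nlinarith

/-- A property from which one can always descend, by a generator, until reaching the generated
subgroup, only holds on that subgroup. -/
theorem mem_closure_of_descent (P : GL (Fin 6) ℤ → Prop) (f : GL (Fin 6) ℤ → ℕ)
    (step : ∀ A, P A → A ∈ Subgroup.closure (Set.range gen) ∨
      ∃ k, P (gen k * A) ∧ f (gen k * A) < f A)
    {A : GL (Fin 6) ℤ} (hA : P A) : A ∈ Subgroup.closure (Set.range gen) := by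
  induction hn : f A using Nat.strong_induction_on generalizing A with
  | _ n ih =>
    rcases step A hA with h | ⟨k, hk, hlt⟩
    · exact h
    · exact (Subgroup.mul_mem_cancel_left _ (Subgroup.subset_closure (Set.mem_range_self k))).mp
        (ih _ (hn ▸ hlt) hk rfl)

theorem gen_mul_mulVec (k : Fin 6) (A : GL (Fin 6) ℤ) (w : Fin 6 → ℤ) :
    ((gen k * A : GL (Fin 6) ℤ) : Matrix (Fin 6) (Fin 6) ℤ) *ᵥ w =
      genMat k *ᵥ ((A : Matrix (Fin 6) (Fin 6) ℤ) *ᵥ w) := by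
  rw [Units.val_mul, ← mulVec_mulVec]
  rfl

theorem gen_mul_apply_last {k : Fin 6} (hk : k ≠ 4) (A : GL (Fin 6) ℤ) (j : Fin 6) :
    (gen k * A : GL (Fin 6) ℤ) 5 j = A 5 j := by
  have h : genMat k 5 = Pi.single 5 1 := by
    revert k; decide +kernel
  change (genMat k * (A : Matrix (Fin 6) (Fin 6) ℤ)) 5 j = _
  simp [Matrix.mul_apply, h, Pi.single_apply]

/-- An integral unit vector that pairs nonnegatively with `(5, 4, 3, 2, 1)` is a standard basis
vector, and this pairing detects which one. -/
theorem unit_vector_cases {a b c d e : ℤ} (h : a * a + b * b + c * c + d * d + e * e = 1)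
    (hn : 0 ≤ 5 * a + 4 * b + 3 * c + 2 * d + e) :
    (a = 1 ∧ b = 0 ∧ c = 0 ∧ d = 0 ∧ e = 0) ∨ (a = 0 ∧ b = 1 ∧ c = 0 ∧ d = 0 ∧ e = 0) ∨
    (a = 0 ∧ b = 0 ∧ c = 1 ∧ d = 0 ∧ e = 0) ∨ (a = 0 ∧ b = 0 ∧ c = 0 ∧ d = 1 ∧ e = 0) ∨
    (a = 0 ∧ b = 0 ∧ c = 0 ∧ d = 0 ∧ e = 1) := by
  have bound (t : ℤ) (ht : t * t ≤ 1) : t = -1 ∨ t = 0 ∨ t = 1 := by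
    have : -1 ≤ t := by nlinarith
    have : t ≤ 1 := by nlinarith
    omega
  rcases bound a (by nlinarith) with rfl | rfl | rfl <;>
  rcases bound b (by nlinarith) with rfl | rfl | rfl <;>
  rcases bound c (by nlinarith) with rfl | rfl | rfl <;>
  rcases bound d (by nlinarith) with rfl | rfl | rfl <;>
  rcases bound e (by nlinarith) with rfl | rfl | rfl <;> omega

/-- A Lorentzian matrix with last diagonal entry `1` fixes the base point. -/
theorem IsLorentzian.apply_eq_zero {A : Matrix (Fin 6) (Fin 6) ℤ} (hA : IsLorentzian A)
    (h55 : A 5 5 = 1) {j : Fin 6} (hj : j ≠ 5) : A j 5 = 0 ∧ A 5 j = 0 := by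
  have hcol : lorSq (A *ᵥ Pi.single 5 1) = -1 := by
    rw [hA.lorSq_mulVec]; decide
  simp only [lorSq, mulVec_single_one, col_apply, h55] at hcol
  have hrow := hA.row_product 5 5
  simp only [h55, show lorJ 5 5 = -1 from rfl] at hrow
  constructor <;> refine (pow_eq_zero_iff two_ne_zero).mp (?_ : _ = (0 : ℤ)) <;>
    fin_cases j <;> first | exact absurd rfl hj | (dsimp; nlinarith)

/-- A Lorentzian matrix fixing the base point and mapping the regular vector `(5, 4, 3, 2, 1, 8)`
into the chamber of the signed permutation group is the identity. -/
theorem eq_one_of_sorted {A : Matrix (Fin 6) (Fin 6) ℤ} (hA : IsLorentzian A) (h55 : A 5 5 = 1)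
    (hs : let y := A *ᵥ ![5, 4, 3, 2, 1, 8]
      y 1 ≤ y 0 ∧ y 2 ≤ y 1 ∧ y 3 ≤ y 2 ∧ y 4 ≤ y 3 ∧ 0 ≤ y 4) : A = 1 := by
  let r (i : Fin 6) : ℤ := 5 * A i 0 + 4 * A i 1 + 3 * A i 2 + 2 * A i 3 + A i 4
  have hr (i : Fin 6) (hi : i ≠ 5) : (A *ᵥ ![5, 4, 3, 2, 1, 8]) i = r i := by
    simp [mulVec, dotProduct, Fin.sum_univ_six, (hA.apply_eq_zero h55 hi).1, r]
    ring
  simp only [hr 0 (by decide), hr 1 (by decide), hr 2 (by decide), hr 3 (by decide),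
    hr 4 (by decide)] at hs
  obtain ⟨h01, h12, h23, h34, h4⟩ := hs
  have hdiag : ∀ i : Fin 6, i ≠ 5 → lorJ i i = 1 := by decide
  have hunit (i : Fin 6) (hi : i ≠ 5) (h0 : 0 ≤ r i) :
      1 ≤ r i ∧ r i ≤ 5 ∧ A i 0 = (if r i = 5 then 1 else 0) ∧
        A i 1 = (if r i = 4 then 1 else 0) ∧ A i 2 = (if r i = 3 then 1 else 0) ∧
        A i 3 = (if r i = 2 then 1 else 0) ∧ A i 4 = (if r i = 1 then 1 else 0) := by
    have h := hA.row_product i i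
    rw [(hA.apply_eq_zero h55 hi).1, hdiag i hi] at h
    rcases unit_vector_cases (by linarith) h0 with h | h | h | h | h <;>
      obtain ⟨ha, hb, hc, hd, he⟩ := h <;> simp [r, ha, hb, hc, hd, he]
  have hne (i j : Fin 6) (hij : i ≠ j) (hi : i ≠ 5) (hj : j ≠ 5) (h0 : 0 ≤ r i) :
      r i ≠ r j := by
    intro h
    obtain ⟨-, -, hi0, hi1, hi2, hi3, hi4⟩ := hunit i hi h0
    obtain ⟨-, -, hj0, hj1, hj2, hj3, hj4⟩ := hunit j hj (h ▸ h0)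
    rw [← h] at hj0 hj1 hj2 hj3 hj4
    have hii := hA.row_product i i
    have hij' := hA.row_product i j
    rw [hj0, hj1, hj2, hj3, hj4, ← hi0, ← hi1, ← hi2, ← hi3, ← hi4,
      (hA.apply_eq_zero h55 hj).1, ← (hA.apply_eq_zero h55 hi).1, hii, hdiag i hi, lorJ,
      diagonal_apply_ne _ hij] at hij'
    exact one_ne_zero hij'
  have n01 := hne 0 1 (by decide) (by decide) (by decide) (by linarith)
  have n12 := hne 1 2 (by decide) (by decide) (by decide) (by linarith)
  have n23 := hne 2 3 (by decide) (by decide) (by decide) (by linarith)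
  have n34 := hne 3 4 (by decide) (by decide) (by decide) (by linarith)
  obtain ⟨-, u0, a0⟩ := hunit 0 (by decide) (by linarith)
  have a1 := (hunit 1 (by decide) (by linarith)).2.2
  have a2 := (hunit 2 (by decide) (by linarith)).2.2
  have a3 := (hunit 3 (by decide) (by linarith)).2.2
  obtain ⟨l4, -, a4⟩ := hunit 4 (by decide) (by linarith)
  rw [show r 0 = 5 by omega] at a0
  rw [show r 1 = 4 by omega] at a1
  rw [show r 2 = 3 by omega] at a2
  rw [show r 3 = 2 by omega] at a3
  rw [show r 4 = 1 by omega] at a4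
  have hz (j : Fin 6) (hj : j ≠ 5) := hA.apply_eq_zero h55 hj
  ext i j
  fin_cases i <;> fin_cases j <;> simp [a0, a1, a2, a3, a4, h55, hz]

/-- A positive Lorentzian matrix fixing the base point lies in the generated subgroup. -/
theorem mem_closure_of_apply_last_eq_one {Γ : Subgroup (GL (Fin 6) ℤ)}
    (hΓ : ∀ A : GL (Fin 6) ℤ, A ∈ Γ ↔ IsPosLorentzian (A : Matrix (Fin 6) (Fin 6) ℤ))
    {A : GL (Fin 6) ℤ} (hA : A ∈ Γ) (h55 : A 5 5 = 1) :
    A ∈ Subgroup.closure (Set.range gen) := by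
  refine mem_closure_of_descent (fun A ↦ A ∈ Γ ∧ A 5 5 = 1)
    (fun A ↦ (height ((A : Matrix (Fin 6) (Fin 6) ℤ) *ᵥ ![5, 4, 3, 2, 1, 8])).toNat)
    ?_ ⟨hA, h55⟩
  rintro A ⟨hA, h55⟩
  have hL := ((hΓ A).mp hA).1
  rcases exists_height_lt_or_sorted ((A : Matrix (Fin 6) (Fin 6) ℤ) *ᵥ ![5, 4, 3, 2, 1, 8])
    with ⟨k, hk, hlt⟩ | hs
  · refine .inr ⟨k, ⟨Γ.mul_mem ((hΓ _).mpr (isPosLorentzian_gen k)) hA, ?_⟩, ?_⟩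
    · rw [gen_mul_apply_last hk, h55]
    · rw [gen_mul_mulVec]
      refine (Int.toNat_lt_toNat (height_pos ?_ ?_)).mpr hlt
      · rw [hL.lorSq_mulVec]; decide
      · simp [mulVec, dotProduct, Fin.sum_univ_six, h55, hL.apply_eq_zero h55]
  · left
    rw [show A = 1 from Units.ext (eq_one_of_sorted hL h55 hs)]
    exact Subgroup.one_mem _

theorem le_closure_range_gen {Γ : Subgroup (GL (Fin 6) ℤ)}
    (hΓ : ∀ A : GL (Fin 6) ℤ, A ∈ Γ ↔ IsPosLorentzian (A : Matrix (Fin 6) (Fin 6) ℤ)) :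
    Γ ≤ Subgroup.closure (Set.range gen) := by
  intro A hA
  refine mem_closure_of_descent (· ∈ Γ)
    (fun A ↦ (height ((A : Matrix (Fin 6) (Fin 6) ℤ) *ᵥ Pi.single 5 1)).toNat) ?_ hA
  intro A hA
  obtain ⟨hL, hpos⟩ := (hΓ A).mp hA
  set y := (A : Matrix (Fin 6) (Fin 6) ℤ) *ᵥ Pi.single 5 1 with hy
  have hy5 : y 5 = A 5 5 := by rw [hy, mulVec_single_one, col_apply]
  have hsq : lorSq y = -1 := by
    rw [hy, hL.lorSq_mulVec]; decide
  have lower (k : Fin 6) (hlt : height (genMat k *ᵥ y) < height y) :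
      ∃ k, gen k * A ∈ Γ ∧
        (height (((gen k * A : GL (Fin 6) ℤ) : Matrix (Fin 6) (Fin 6) ℤ) *ᵥ
          Pi.single 5 1)).toNat < (height y).toNat := by
    refine ⟨k, Γ.mul_mem ((hΓ _).mpr (isPosLorentzian_gen k)) hA, ?_⟩
    rw [gen_mul_mulVec]
    exact (Int.toNat_lt_toNat (height_pos (by omega) (hy5 ▸ hpos))).mpr hlt
  rcases (show (1 : ℤ) ≤ A 5 5 from hpos).eq_or_lt with h | h
  · exact .inl (mem_closure_of_apply_last_eq_one hΓ hA h.symm)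
  · right
    rcases exists_height_lt_or_sorted y with ⟨k, -, hlt⟩ | ⟨h01, h12, h23, h34, h4⟩
    · exact lower k hlt
    · exact lower 4 (height_Vmat_lt hsq (hy5 ▸ h) h01 h12 h23 h34 h4)

/-- The group `Γ⁵` of integral, positive, Lorentzian 6×6 matrices is generated by the
permutation matrices of (1 2), (2 3), (3 4), (4 5), the matrix `V`, and `D`. -/
theorem gamma5_generated_by_six_matrices
    (Γ5 : Subgroup (GL (Fin 6) ℤ))
    (hΓ5 : ∀ A : GL (Fin 6) ℤ, A ∈ Γ5 ↔ IsPosLorentzian (A : Matrix (Fin 6) (Fin 6) ℤ))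
    (g12 g23 g34 g45 v d : GL (Fin 6) ℤ)
    (h12 : (g12 : Matrix (Fin 6) (Fin 6) ℤ) = P12)
    (h23 : (g23 : Matrix (Fin 6) (Fin 6) ℤ) = P23)
    (h34 : (g34 : Matrix (Fin 6) (Fin 6) ℤ) = P34)
    (h45 : (g45 : Matrix (Fin 6) (Fin 6) ℤ) = P45)
    (hv : (v : Matrix (Fin 6) (Fin 6) ℤ) = Vmat)
    (hd : (d : Matrix (Fin 6) (Fin 6) ℤ) = Dmat) :
    Subgroup.closure {g12, g23, g34, g45, v, d} = Γ5 := by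
  have hrange : ({g12, g23, g34, g45, v, d} : Set (GL (Fin 6) ℤ)) = Set.range gen := by
    rw [show g12 = gen 0 from Units.ext h12, show g23 = gen 1 from Units.ext h23,
      show g34 = gen 2 from Units.ext h34, show g45 = gen 3 from Units.ext h45,
      show v = gen 4 from Units.ext hv, show d = gen 5 from Units.ext hd]
    ext A
    simp [Fin.exists_fin_succ, eq_comm]
  rw [hrange]
  refine le_antisymm ?_ (le_closure_range_gen hΓ5)
  rw [Subgroup.closure_le]
  rintro _ ⟨k, rfl⟩
  exact (hΓ5 _).mpr (isPosLorentzian_gen k)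
end

section
/- The subgroup Σ⁵ of Γ⁵ generated by the 6×6 permutation matrices of the coordinate transpositions (1 2), (2 3), (3 4), (4 5) and the matrix V is a finite group of order 1920. -/
open Matrix

/-- The vectors `2 • eᵢ - (1, 1, 1, 1, 1, 1)`, which `Σ⁵` permutes up to sign. -/
def frameVec (i : Fin 5) : Fin 6 → ℤ := fun j => if j = i.castSucc then 1 else -1

/-- The time-like vector fixed by `Σ⁵`. -/
def axisVec : Fin 6 → ℤ := ![1, 1, 1, 1, 1, 3]

/-- `A` fixes the axis and acts on the frame as the signed permutation `(σ, ε)`. -/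
def ActsAs (A : GL (Fin 6) ℤ) (σ : Equiv.Perm (Fin 5)) (ε : Fin 5 → ℤˣ) : Prop :=
  (∀ i, (A : Matrix (Fin 6) (Fin 6) ℤ) *ᵥ frameVec i = (ε (σ i) : ℤ) • frameVec (σ i)) ∧
    (A : Matrix (Fin 6) (Fin 6) ℤ) *ᵥ axisVec = axisVec

lemma ActsAs.one : ActsAs 1 1 1 := by
  constructor <;> simp

lemma ActsAs.mul {A B : GL (Fin 6) ℤ} {σ τ : Equiv.Perm (Fin 5)} {ε δ : Fin 5 → ℤˣ}
    (hA : ActsAs A σ ε) (hB : ActsAs B τ δ) :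
    ActsAs (A * B) (σ * τ) (ε * δ ∘ ⇑σ⁻¹) := by
  refine ⟨fun i => ?_, ?_⟩
  · rw [Units.val_mul, ← mulVec_mulVec, hB.1, mulVec_smul, hA.1, smul_smul]
    simp [mul_comm]
  · rw [Units.val_mul, ← mulVec_mulVec, hB.2, hA.2]

lemma ActsAs.inv {A : GL (Fin 6) ℤ} {σ : Equiv.Perm (Fin 5)} {ε : Fin 5 → ℤˣ}
    (hA : ActsAs A σ ε) : ActsAs A⁻¹ σ⁻¹ (ε ∘ σ) := by
  have cancel (x : Fin 6 → ℤ) : (↑A⁻¹ : Matrix (Fin 6) (Fin 6) ℤ) *ᵥ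
      ((A : Matrix (Fin 6) (Fin 6) ℤ) *ᵥ x) = x := by
    rw [mulVec_mulVec, ← Units.val_mul, inv_mul_cancel, Units.val_one, one_mulVec]
  refine ⟨fun i => ?_, ?_⟩
  · have h := congrArg (fun x => (ε i : ℤ) • x) (cancel (frameVec (σ⁻¹ i)))
    simp only [hA.1, Equiv.Perm.coe_inv, Equiv.apply_symm_apply, mulVec_smul, smul_smul] at h
    simpa [← Units.val_mul] using h
  · conv_lhs => rw [← hA.2]
    exact cancel _

lemma signed_frameVec_inj :
    ∀ (i j : Fin 5) (a b : ℤˣ), (a : ℤ) • frameVec i = (b : ℤ) • frameVec j → i = j ∧ a = b := by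
  decide

lemma ActsAs.unique {A : GL (Fin 6) ℤ} {σ τ : Equiv.Perm (Fin 5)} {ε δ : Fin 5 → ℤˣ}
    (h : ActsAs A σ ε) (h' : ActsAs A τ δ) : σ = τ ∧ ε = δ := by
  have key i := signed_frameVec_inj _ _ _ _ ((h.1 i).symm.trans (h'.1 i))
  have hσ : σ = τ := Equiv.ext fun i => (key i).1
  subst hσ
  refine ⟨rfl, funext fun j => ?_⟩
  simpa using (key (σ.symm j)).2

lemma four_smul_eq_frame_expansion (x : Fin 6 → ℤ) :
    (4 : ℤ) • x = ∑ i, (frameVec i ⬝ᵥ (lorJ *ᵥ x)) • frameVec i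
      - (axisVec ⬝ᵥ (lorJ *ᵥ x)) • axisVec := by
  ext j
  fin_cases j <;>
    simp [lorJ, mulVec_diagonal, dotProduct, Fin.sum_univ_succ, frameVec, axisVec] <;> ring

lemma ActsAs.eq {A B : GL (Fin 6) ℤ} {σ : Equiv.Perm (Fin 5)} {ε : Fin 5 → ℤˣ}
    (hA : ActsAs A σ ε) (hB : ActsAs B σ ε) : A = B := by
  refine Units.ext (ext_of_mulVec_single fun i => ?_)
  have h4 : (4 : ℤ) • ((A : Matrix (Fin 6) (Fin 6) ℤ) *ᵥ Pi.single i 1) =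
      (4 : ℤ) • ((B : Matrix (Fin 6) (Fin 6) ℤ) *ᵥ Pi.single i 1) := by
    rw [← mulVec_smul, ← mulVec_smul, four_smul_eq_frame_expansion]
    simp only [mulVec_sub, mulVec_sum, mulVec_smul, hA.1, hB.1, hA.2, hB.2]
  exact smul_right_injective _ (by norm_num) h4

/-- The sign vector that is `-1` exactly at the adjacent positions `i` and `i + 1`. -/
def adjacentFlip (i : Fin 4) : Fin 5 → ℤˣ :=
  Pi.mulSingle i.castSucc (-1) * Pi.mulSingle i.succ (-1)

lemma exists_adjacentFlip_comp_eq (i : Fin 4) :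
    ∃ σ : Equiv.Perm (Fin 5), adjacentFlip 3 ∘ σ = adjacentFlip i := by
  fin_cases i
  · exact ⟨Equiv.swap 0 3 * Equiv.swap 1 4, by decide⟩
  · exact ⟨Equiv.swap 1 3 * Equiv.swap 2 4, by decide⟩
  · exact ⟨Equiv.swap 2 4, by decide⟩
  · exact ⟨1, by decide⟩

lemma exists_prod_adjacentFlip_eq :
    ∀ ε : Fin 5 → ℤˣ, ∏ i, ε i = 1 → ∃ s : Finset (Fin 4), ∏ i ∈ s, adjacentFlip i = ε := by
  decide

lemma card_signs_prod_eq_one : Nat.card {ε : Fin 5 → ℤˣ // ∏ i, ε i = 1} = 16 := by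
  rw [Nat.card_eq_fintype_card]
  decide

lemma isPosLorentzian_generators : IsPosLorentzian P12 ∧ IsPosLorentzian P23 ∧
    IsPosLorentzian P34 ∧ IsPosLorentzian P45 ∧ IsPosLorentzian Vmat := by
  unfold IsPosLorentzian IsLorentzian
  decide

/-- A subgroup acting by even signed permutations, which realises all adjacent transpositions
and one adjacent pair of sign changes, realises every even signed permutation exactly once. -/
lemma card_eq_of_actsAs (G : Subgroup (GL (Fin 6) ℤ))
    (hG : ∀ A ∈ G, ∃ σ ε, ∏ i, ε i = 1 ∧ ActsAs A σ ε)
    (hswap : ∀ i : Fin 4, ∃ A ∈ G, ActsAs A (Equiv.swap i.castSucc i.succ) 1)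
    (hflip : ∃ A ∈ G, ActsAs A 1 (adjacentFlip 3)) : Nat.card G = 1920 := by
  have hperm (σ : Equiv.Perm (Fin 5)) : ∃ A ∈ G, ActsAs A σ 1 := by
    have hσ : σ ∈ Submonoid.closure
        (Set.range fun i : Fin 4 => Equiv.swap i.castSucc i.succ) := by
      rw [Equiv.Perm.mclosure_swap_castSucc_succ]
      trivial
    induction hσ using Submonoid.closure_induction with
    | mem x hx =>
      obtain ⟨i, rfl⟩ := hx
      exact hswap i
    | one => exact ⟨1, G.one_mem, .one⟩
    | mul x y _ _ hx hy =>
      obtain ⟨A, hA, hA'⟩ := hx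
      obtain ⟨B, hB, hB'⟩ := hy
      exact ⟨A * B, G.mul_mem hA hB, by simpa using hA'.mul hB'⟩
  have hflips (i : Fin 4) : ∃ A ∈ G, ActsAs A 1 (adjacentFlip i) := by
    obtain ⟨σ, hσ⟩ := exists_adjacentFlip_comp_eq i
    obtain ⟨A, hA, hA'⟩ := hperm σ
    obtain ⟨B, hB, hB'⟩ := hflip
    refine ⟨A⁻¹ * B * A, G.mul_mem (G.mul_mem (G.inv_mem hA) hB) hA, ?_⟩
    simpa [← hσ, Pi.one_comp] using (hA'.inv.mul hB').mul hA'
  have hsign (s : Finset (Fin 4)) : ∃ A ∈ G, ActsAs A 1 (∏ i ∈ s, adjacentFlip i) := by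
    induction s using Finset.induction_on with
    | empty => exact ⟨1, G.one_mem, by simpa using ActsAs.one⟩
    | insert i s hi ih =>
      obtain ⟨A, hA, hA'⟩ := hflips i
      obtain ⟨B, hB, hB'⟩ := ih
      exact ⟨A * B, G.mul_mem hA hB, by simpa [Finset.prod_insert hi] using hA'.mul hB'⟩
  choose σ ε hε hact using fun A : G => hG A A.2
  let toSigned (A : G) : Equiv.Perm (Fin 5) × {δ : Fin 5 → ℤˣ // ∏ i, δ i = 1} :=
    (σ A, ⟨ε A, hε A⟩)
  have hbij : Function.Bijective toSigned := by
    constructor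
    · intro A B hAB
      have hσ : σ A = σ B := congrArg Prod.fst hAB
      have hε' : ε A = ε B := congrArg (fun p => p.2.1) hAB
      have hA := hact A
      rw [hσ, hε'] at hA
      exact Subtype.ext (hA.eq (hact B))
    · rintro ⟨τ, δ, hδ⟩
      obtain ⟨s, rfl⟩ := exists_prod_adjacentFlip_eq δ hδ
      obtain ⟨A, hA, hA'⟩ := hsign s
      obtain ⟨B, hB, hB'⟩ := hperm τ
      have hAB : ActsAs (A * B) τ (∏ i ∈ s, adjacentFlip i) := by simpa using hA'.mul hB'
      obtain ⟨h₁, h₂⟩ := (hact ⟨A * B, G.mul_mem hA hB⟩).unique hAB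
      exact ⟨_, Prod.ext h₁ (Subtype.ext h₂)⟩
  rw [Nat.card_congr (Equiv.ofBijective toSigned hbij),
    Nat.card_prod, card_signs_prod_eq_one, Nat.card_perm, Nat.card_fin]
  rfl

/-- The subgroup `Σ⁵` of `Γ⁵` generated by the permutation matrices of the transpositions
(1 2), (2 3), (3 4), (4 5) and by the matrix `V` is a finite group of order 1920. -/
theorem sigma5_has_order_1920
    (Γ5 : Subgroup (GL (Fin 6) ℤ))
    (hΓ5 : ∀ A : GL (Fin 6) ℤ, A ∈ Γ5 ↔ IsPosLorentzian (A : Matrix (Fin 6) (Fin 6) ℤ))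
    (g12 g23 g34 g45 v : GL (Fin 6) ℤ)
    (h12 : (g12 : Matrix (Fin 6) (Fin 6) ℤ) = P12)
    (h23 : (g23 : Matrix (Fin 6) (Fin 6) ℤ) = P23)
    (h34 : (g34 : Matrix (Fin 6) (Fin 6) ℤ) = P34)
    (h45 : (g45 : Matrix (Fin 6) (Fin 6) ℤ) = P45)
    (hv : (v : Matrix (Fin 6) (Fin 6) ℤ) = Vmat) :
    Subgroup.closure {g12, g23, g34, g45, v} ≤ Γ5 ∧
      Nat.card (Subgroup.closure {g12, g23, g34, g45, v} : Subgroup (GL (Fin 6) ℤ)) = 1920 := by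
  have a12 : ActsAs g12 (Equiv.swap 0 1) 1 := by unfold ActsAs; rw [h12]; decide
  have a23 : ActsAs g23 (Equiv.swap 1 2) 1 := by unfold ActsAs; rw [h23]; decide
  have a34 : ActsAs g34 (Equiv.swap 2 3) 1 := by unfold ActsAs; rw [h34]; decide
  have a45 : ActsAs g45 (Equiv.swap 3 4) 1 := by unfold ActsAs; rw [h45]; decide
  have av : ActsAs v (Equiv.swap 3 4) (adjacentFlip 3) := by unfold ActsAs; rw [hv]; decide
  have hgen : ∀ x ∈ ({g12, g23, g34, g45, v} : Set (GL (Fin 6) ℤ)),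
      x ∈ Subgroup.closure {g12, g23, g34, g45, v} := fun x hx => Subgroup.subset_closure hx
  simp only [Set.mem_insert_iff, Set.mem_singleton_iff, forall_eq_or_imp, forall_eq] at hgen
  obtain ⟨m12, m23, m34, m45, mv⟩ := hgen
  refine ⟨?_, card_eq_of_actsAs _ (fun A hA => ?_) (fun i => ?_) ?_⟩
  · rw [Subgroup.closure_le]
    obtain ⟨p12, p23, p34, p45, pv⟩ := isPosLorentzian_generators
    rintro x (rfl | rfl | rfl | rfl | rfl) <;> rw [SetLike.mem_coe, hΓ5]
    · rwa [h12]
    · rwa [h23]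
    · rwa [h34]
    · rwa [h45]
    · rwa [hv]
  · induction hA using Subgroup.closure_induction with
    | mem x hx =>
      obtain rfl | rfl | rfl | rfl | rfl := hx
      · exact ⟨_, _, by simp, a12⟩
      · exact ⟨_, _, by simp, a23⟩
      · exact ⟨_, _, by simp, a34⟩
      · exact ⟨_, _, by simp, a45⟩
      · exact ⟨_, _, by decide, av⟩
    | one => exact ⟨_, _, by simp, .one⟩
    | mul x y _ _ hx hy =>
      obtain ⟨σ, ε, hε, hx⟩ := hx
      obtain ⟨τ, δ, hδ, hy⟩ := hy
      refine ⟨_, _, ?_, hx.mul hy⟩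
      simp [Finset.prod_mul_distrib, hε, Equiv.prod_comp σ.symm δ, hδ]
    | inv x _ hx =>
      obtain ⟨σ, ε, hε, hx⟩ := hx
      exact ⟨_, _, (Equiv.prod_comp σ ε).trans hε, hx.inv⟩
  · fin_cases i
    · exact ⟨_, m12, a12⟩
    · exact ⟨_, m23, a23⟩
    · exact ⟨_, m34, a34⟩
    · exact ⟨_, m45, a45⟩
  · exact ⟨v * g45, mul_mem mv m45, by simpa [Pi.one_comp] using av.mul a45⟩
end

section
/- No nonidentity element of the subgroup Σ⁵ lies in the congruence two subgroup Γ⁵₂; that is, Σ⁵ ∩ Γ⁵₂ = {I}. -/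
open Matrix

/-- A matrix is congruent to the identity matrix modulo two. -/
def CongrIdModTwo (A : Matrix (Fin 6) (Fin 6) ℤ) : Prop :=
  ∀ i j, (2 : ℤ) ∣ (A i j - (1 : Matrix (Fin 6) (Fin 6) ℤ) i j)

/-- The row vector `kᵀJ`, where `k = (1,1,1,1,1,3)` is the timelike vector fixed by `Σ⁵`. -/
def kRow : Fin 6 → ℤ := ![1, 1, 1, 1, 1, -3]

/-- Every matrix in a subgroup generated by matrices fixing a row vector fixes it. -/
theorem vecMul_eq_of_mem_closure {n R : Type*} [Fintype n] [DecidableEq n] [CommRing R]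
    {S : Set (GL n R)} {u : n → R} (hS : ∀ g ∈ S, u ᵥ* (g : Matrix n n R) = u)
    {g : GL n R} (hg : g ∈ Subgroup.closure S) : u ᵥ* (g : Matrix n n R) = u := by
  induction hg using Subgroup.closure_induction with
  | mem x hx => exact hS x hx
  | one => simp
  | mul x y _ _ hx hy => rw [Units.val_mul, ← vecMul_vecMul, hx, hy]
  | inv x _ hx =>
    conv_lhs => rw [← hx]
    rw [vecMul_vecMul, ← Units.val_mul, mul_inv_cancel, Units.val_one, vecMul_one]

/-- If `e` is a spacelike basis vector, the only vector `b` orthogonal to `k` for which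
`e + 2b` has norm one is `b = 0`. Here `x` is the coordinate of `b` along `e`, and `w` is its
timelike coordinate. -/
theorem eq_zero_of_norm_add_two_mul {x p q r t w : ℤ}
    (hnorm : x ^ 2 + x + p ^ 2 + q ^ 2 + r ^ 2 + t ^ 2 = w ^ 2)
    (hk : x + p + q + r + t = 3 * w) :
    x = 0 ∧ p = 0 ∧ q = 0 ∧ r = 0 ∧ t = 0 ∧ w = 0 := by
  have hbound : 4 * x ^ 2 + 9 * x + 4 * (p ^ 2 + q ^ 2 + r ^ 2 + t ^ 2) ≤ 0 := by
    have hsq : (x + p + q + r + t) ^ 2 = 9 * w ^ 2 := by rw [hk]; ring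
    nlinarith [sq_nonneg (x - p), sq_nonneg (x - q), sq_nonneg (x - r), sq_nonneg (x - t),
      sq_nonneg (p - q), sq_nonneg (p - r), sq_nonneg (p - t), sq_nonneg (q - r),
      sq_nonneg (q - t), sq_nonneg (r - t)]
  have hx₀ : x ≤ 0 := by nlinarith [sq_nonneg x, sq_nonneg p, sq_nonneg q, sq_nonneg r, sq_nonneg t]
  have hx₂ : -2 ≤ x := by nlinarith [sq_nonneg p, sq_nonneg q, sq_nonneg r, sq_nonneg t]
  have hx : 2 ∣ x := by
    have parity (y : ℤ) : 2 ∣ y ^ 2 - y := by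
      have h := (Int.even_mul_pred_self y).two_dvd
      rwa [mul_sub_one, ← sq] at h
    have := parity x
    have := parity p
    have := parity q
    have := parity r
    have := parity t
    have := parity w
    omega
  have vanish {y : ℤ} (hy : y ^ 2 ≤ 0) : y = 0 := pow_eq_zero_iff two_ne_zero |>.1 (le_antisymm hy (sq_nonneg y))
  have hS : p ^ 2 + q ^ 2 + r ^ 2 + t ^ 2 ≤ 0 := by
    interval_cases x <;> omega
  obtain rfl : p = 0 := vanish (by linarith [sq_nonneg q, sq_nonneg r, sq_nonneg t])
  obtain rfl : q = 0 := vanish (by linarith [sq_nonneg r, sq_nonneg t])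
  obtain rfl : r = 0 := vanish (by linarith [sq_nonneg t])
  obtain rfl : t = 0 := vanish (by linarith)
  interval_cases x <;> omega

/-- A Lorentzian matrix congruent to the identity modulo two and fixing the row vector `kᵀJ`
is the identity. -/
theorem eq_one_of_isLorentzian_of_congrIdModTwo {A : Matrix (Fin 6) (Fin 6) ℤ}
    (hA : IsLorentzian A) (h2 : CongrIdModTwo A) (hk : kRow ᵥ* A = kRow) : A = 1 := by
  have form (i j : Fin 6) : A 0 i * A 0 j + A 1 i * A 1 j + A 2 i * A 2 j + A 3 i * A 3 j +
      A 4 i * A 4 j - A 5 i * A 5 j = lorJ i j := by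
    rw [← congrFun₂ hA i j]
    simp [lorJ, Matrix.mul_apply, Fin.sum_univ_six]
    ring
  have row (j : Fin 6) : A 0 j + A 1 j + A 2 j + A 3 j + A 4 j - 3 * A 5 j = kRow j := by
    rw [← congrFun hk j]
    simp [kRow, Matrix.vecMul, dotProduct, Fin.sum_univ_six]
    ring
  choose B hB using h2
  have hAB (i j : Fin 6) : A i j = (1 : Matrix (Fin 6) (Fin 6) ℤ) i j + 2 * B i j := by
    linarith [hB i j]
  have spacelike (j : Fin 6) (hj : j ≠ 5) (i : Fin 6) : B i j = 0 := by
    have hf := form j j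
    have hr := row j
    simp only [hAB] at hf hr
    fin_cases j
    all_goals simp [Matrix.one_apply, lorJ, kRow] at hf hr hj ⊢
    · have h := @eq_zero_of_norm_add_two_mul (B 0 0) (B 1 0) (B 2 0) (B 3 0) (B 4 0) (B 5 0)
        (by linarith) (by linarith)
      fin_cases i <;> simp [h]
    · have h := @eq_zero_of_norm_add_two_mul (B 1 1) (B 0 1) (B 2 1) (B 3 1) (B 4 1) (B 5 1)
        (by linarith) (by linarith)
      fin_cases i <;> simp [h]
    · have h := @eq_zero_of_norm_add_two_mul (B 2 2) (B 0 2) (B 1 2) (B 3 2) (B 4 2) (B 5 2)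
        (by linarith) (by linarith)
      fin_cases i <;> simp [h]
    · have h := @eq_zero_of_norm_add_two_mul (B 3 3) (B 0 3) (B 1 3) (B 2 3) (B 4 3) (B 5 3)
        (by linarith) (by linarith)
      fin_cases i <;> simp [h]
    · have h := @eq_zero_of_norm_add_two_mul (B 4 4) (B 0 4) (B 1 4) (B 2 4) (B 3 4) (B 5 4)
        (by linarith) (by linarith)
      fin_cases i <;> simp [h]
  have column (i j : Fin 6) (hj : j ≠ 5) : A i j = (1 : Matrix (Fin 6) (Fin 6) ℤ) i j := by
    rw [hAB, spacelike j hj, mul_zero, add_zero]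
  have orthogonal (j : Fin 6) (hj : j ≠ 5) : A j 5 = 0 := by
    have hf := form j 5
    simp only [column _ j hj] at hf
    fin_cases j <;> simp_all [Matrix.one_apply, lorJ]
  have timelike : A 5 5 = 1 := by
    have hr := row 5
    simp [orthogonal, kRow] at hr
    linarith
  ext i j
  by_cases hj : j = 5
  · subst hj
    by_cases hi : i = 5
    · subst hi
      simpa using timelike
    · rw [orthogonal i hi, Matrix.one_apply_ne hi]
  · exact column i j hj

/-- No nonidentity element of `Σ⁵` lies in the congruence two subgroup `Γ⁵₂`;
that is, `Σ⁵ ⊓ Γ⁵₂ = {I}`. -/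
theorem sigma5_meets_gamma52_trivially
    (Γ5 : Subgroup (GL (Fin 6) ℤ))
    (hΓ5 : ∀ A : GL (Fin 6) ℤ, A ∈ Γ5 ↔ IsPosLorentzian (A : Matrix (Fin 6) (Fin 6) ℤ))
    (Γ52 : Subgroup (GL (Fin 6) ℤ))
    (hΓ52 : ∀ A : GL (Fin 6) ℤ, A ∈ Γ52 ↔
      IsPosLorentzian (A : Matrix (Fin 6) (Fin 6) ℤ) ∧
        CongrIdModTwo (A : Matrix (Fin 6) (Fin 6) ℤ))
    (g12 g23 g34 g45 v : GL (Fin 6) ℤ)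
    (h12 : (g12 : Matrix (Fin 6) (Fin 6) ℤ) = P12)
    (h23 : (g23 : Matrix (Fin 6) (Fin 6) ℤ) = P23)
    (h34 : (g34 : Matrix (Fin 6) (Fin 6) ℤ) = P34)
    (h45 : (g45 : Matrix (Fin 6) (Fin 6) ℤ) = P45)
    (hv : (v : Matrix (Fin 6) (Fin 6) ℤ) = Vmat) :
    Subgroup.closure {g12, g23, g34, g45, v} ⊓ Γ52 = ⊥ := by
  refine (Subgroup.eq_bot_iff_forall _).2 fun g ⟨hg, hg2⟩ => ?_
  obtain ⟨⟨hL, -⟩, hmod⟩ := (hΓ52 g).1 hg2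
  refine Units.ext (eq_one_of_isLorentzian_of_congrIdModTwo hL hmod
    (vecMul_eq_of_mem_closure ?_ hg))
  rintro x (rfl | rfl | rfl | rfl | rfl)
  · rw [h12]; decide
  · rw [h23]; decide
  · rw [h34]; decide
  · rw [h45]; decide
  · rw [hv]; decide
end

section
/- Every nonidentity element of finite order in the congruence two subgroup Γ⁵₂ has order two. -/
open Matrix

/-- An integer matrix `N` with `N = 2 N Y` vanishes, being divisible by every power of two. -/
theorem Matrix.eq_zero_of_eq_two_mul {n : Type*} [Fintype n] [DecidableEq n]
    {N Y : Matrix n n ℤ} (h : N = 2 * (N * Y)) : N = 0 := by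
  have key : ∀ k : ℕ, ∃ D : Matrix n n ℤ, N = (2 ^ k : ℤ) • D := by
    intro k
    induction k with
    | zero => exact ⟨N, by simp⟩
    | succ k ih =>
      obtain ⟨D, hD⟩ := ih
      refine ⟨D * Y, ?_⟩
      rw [hD, smul_mul_assoc] at h
      rw [hD, h, pow_succ, mul_comm, mul_smul, two_mul, two_smul]
  ext i j
  refine Int.eq_zero_of_abs_lt_dvd (m := 2 ^ (N i j).natAbs) ?_ ?_
  · obtain ⟨D, hD⟩ := key (N i j).natAbs
    refine ⟨D i j, ?_⟩
    simpa using congrFun (congrFun hD i) j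
  · rw [Int.abs_eq_natAbs]
    exact_mod_cast Nat.lt_two_pow_self

theorem one_add_pow_eq_linear_add_sq_mul {R : Type*} [Ring R] (N : R) (n : ℕ) :
    ∃ Q : R, (1 + N) ^ n = 1 + n * N + N * N * Q := by
  induction n with
  | zero => exact ⟨0, by simp⟩
  | succ n ih =>
    obtain ⟨Q, hQ⟩ := ih
    refine ⟨n + Q * (1 + N), ?_⟩
    have hn : N * N * (n : R) = n * (N * N) := (Nat.cast_commute n (N * N)).eq.symm
    rw [pow_succ, hQ, mul_add (N * N), hn]
    push_cast
    noncomm_ring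

/-- An integer matrix of finite order congruent to the identity modulo four is the identity. -/
theorem Matrix.eq_one_of_pow_eq_one_of_modFour {n : Type*} [Fintype n] [DecidableEq n]
    (m : ℕ) (hm : 0 < m) (C : Matrix n n ℤ) (h : (1 + 4 * C) ^ m = 1) : 1 + 4 * C = 1 := by
  induction m using Nat.strong_induction_on with
  | _ m ih =>
    obtain ⟨k, rfl | rfl⟩ := Nat.even_or_odd' m
    · refine ih k (by omega) (by omega) ?_
      obtain ⟨Q, hQ⟩ := one_add_pow_eq_linear_add_sq_mul (4 * C) k
      set D : Matrix n n ℤ := k * C + 4 * (C * C) * Q with hD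
      have hk : (1 + 4 * C) ^ k = 1 + 4 * D := by
        rw [hQ, hD, (Nat.cast_commute k (4 * C)).eq, (Nat.cast_commute k C).eq]
        noncomm_ring
      rw [mul_comm, pow_mul, hk] at h
      have h8 : (8 : ℤ) • (D - 2 * (D * -D)) = 0 := by
        rw [← sub_eq_zero.mpr h]
        noncomm_ring
      have hD0 : D = 0 := Matrix.eq_zero_of_eq_two_mul
        (sub_eq_zero.mp ((smul_eq_zero.mp h8).resolve_left (by norm_num)))
      rw [hk, hD0, mul_zero, add_zero]
    · obtain ⟨Q, hQ⟩ := one_add_pow_eq_linear_add_sq_mul (4 * C) (2 * k + 1)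
      rw [h, add_assoc, left_eq_add] at hQ
      have h0 : 4 * C = 0 := by
        apply Matrix.eq_zero_of_eq_two_mul (Y := -(k : Matrix n n ℤ) - 2 * C * Q)
        rw [← sub_eq_zero, ← hQ, mul_sub, mul_neg, ← (Nat.cast_commute k (4 * C)).eq]
        push_cast
        noncomm_ring
      rw [h0, add_zero]

/-- An integer matrix of finite order congruent to the identity modulo two is an involution. -/
theorem Matrix.sq_eq_one_of_pow_eq_one_of_modTwo {n : Type*} [Fintype n] [DecidableEq n]
    {m : ℕ} (hm : 0 < m) (B : Matrix n n ℤ) (h : (1 + 2 * B) ^ m = 1) :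
    (1 + 2 * B) ^ 2 = 1 := by
  have hs : (1 + 2 * B) ^ 2 = 1 + 4 * (B + B * B) := by noncomm_ring
  rw [hs]
  refine Matrix.eq_one_of_pow_eq_one_of_modFour m hm _ ?_
  rw [← hs, ← pow_mul, mul_comm, pow_mul, h, one_pow]

/-- Every nonidentity element of finite order in the congruence two subgroup `Γ⁵₂`
has order two. -/
theorem gamma52_torsion_has_order_two
    (Γ52 : Subgroup (GL (Fin 6) ℤ))
    (hΓ52 : ∀ A : GL (Fin 6) ℤ, A ∈ Γ52 ↔
      IsPosLorentzian (A : Matrix (Fin 6) (Fin 6) ℤ) ∧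
        CongrIdModTwo (A : Matrix (Fin 6) (Fin 6) ℤ)) :
    ∀ g ∈ Γ52, IsOfFinOrder g → g ≠ 1 → orderOf g = 2 := by
  intro g hg hfin hne
  obtain ⟨m, hm, hpow⟩ := isOfFinOrder_iff_pow_eq_one.mp hfin
  choose b hb using ((hΓ52 g).mp hg).2
  have hB : (g : Matrix (Fin 6) (Fin 6) ℤ) = 1 + 2 * Matrix.of b := by
    ext i j
    rw [two_mul]
    simp only [Matrix.add_apply, Matrix.of_apply]
    linarith [hb i j]
  refine orderOf_eq_prime (Units.ext ?_) hne
  rw [Units.val_pow_eq_pow_val, hB, Units.val_one]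
  refine Matrix.sq_eq_one_of_pow_eq_one_of_modTwo hm _ ?_
  rw [← hB, ← Units.val_pow_eq_pow_val, hpow, Units.val_one]
end

section
/- The 72 Lorentz normal vectors of the sides of the polytope Q⁵, namely the 40 vectors ±eᵢ ± eⱼ + e₆ for pairs i < j in {1,…,5} (all four sign choices) and the 32 vectors ±e₁ ± e₂ ± e₃ ± e₄ ± e₅ + 2e₆ (all sign choices), satisfy: each vector s has Lorentzian norm s∘s = 1, and for any two distinct vectors s, t in the list, either s∘t = 0 or s∘t ≤ −1. (This expresses that Q⁵ is a right-angled polytope: adjacent sides meet at right angles, and nonadjacent sides are disjoint or meet at infinity.) -/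
/-- The Lorentzian inner product `x∘y = x₁y₁+⋯+x₅y₅−x₆y₆` on ℝ⁶ (restricted to
integral vectors). -/
def lorInner (x y : Fin 6 → ℤ) : ℤ :=
  x 0 * y 0 + x 1 * y 1 + x 2 * y 2 + x 3 * y 3 + x 4 * y 4 - x 5 * y 5

/-- The 72 Lorentz normal vectors of the sides of the polytope `Q⁵`: the 40 vectors
`±eᵢ ± eⱼ + e₆` for `i < j` in `{1,…,5}` (all four sign choices) and the 32 vectors
`±e₁ ± e₂ ± e₃ ± e₄ ± e₅ + 2e₆` (all sign choices). -/
def sidesQ5 : Set (Fin 6 → ℤ) :=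
  { s | (∃ i j : Fin 5, i < j ∧ ∃ a b : ℤ, (a = 1 ∨ a = -1) ∧ (b = 1 ∨ b = -1) ∧
          s = Pi.single i.castSucc a + Pi.single j.castSucc b + Pi.single 5 1) ∨
        (∃ ε : Fin 5 → ℤ, (∀ i, ε i = 1 ∨ ε i = -1) ∧
          s = (∑ i : Fin 5, Pi.single i.castSucc (ε i)) + Pi.single 5 2) }

/-- A side normal has height `1`, or height `2` and all spatial coordinates of square `1`. -/
lemma height_of_mem_sidesQ5 {s : Fin 6 → ℤ} (hs : s ∈ sidesQ5) :
    s 5 = 1 ∨ s 5 = 2 ∧ ∀ i : Fin 5, s i.castSucc ^ 2 = 1 := by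
  rcases hs with ⟨i, j, -, a, b, -, -, rfl⟩ | ⟨ε, hε, rfl⟩
  · left
    fin_cases i <;> fin_cases j <;> simp
  · right
    refine ⟨by simp [Fin.sum_univ_five], fun i => ?_⟩
    have h : ε i ^ 2 = 1 := by rcases hε i with h | h <;> simp [h]
    fin_cases i <;> simpa [Fin.sum_univ_five, Pi.single_apply] using h

lemma lorInner_self_of_mem_sidesQ5 {s : Fin 6 → ℤ} (hs : s ∈ sidesQ5) :
    lorInner s s = 1 := by
  rcases hs with ⟨i, j, hij, a, b, ha, hb, rfl⟩ | ⟨ε, hε, rfl⟩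
  · have ha' : a * a = 1 := by rcases ha with rfl | rfl <;> rfl
    have hb' : b * b = 1 := by rcases hb with rfl | rfl <;> rfl
    fin_cases i <;> fin_cases j <;>
      first
      | exact absurd hij (by decide)
      | simp [lorInner, ha', hb']
  · have h (i) : ε i * ε i = 1 := by rcases hε i with h | h <;> simp [h]
    simp [lorInner, Fin.sum_univ_five, h]

/-- Distinct unit vectors of equal height differ by a nonzero spacelike vector. -/
lemma lorInner_nonpos_of_height_eq {s t : Fin 6 → ℤ} (hs : lorInner s s = 1)
    (ht : lorInner t t = 1) (h : s 5 = t 5) (hst : s ≠ t) : lorInner s t ≤ 0 := by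
  by_contra! hpos
  apply hst
  have hsum : (s 0 - t 0) ^ 2 + (s 1 - t 1) ^ 2 + (s 2 - t 2) ^ 2 + (s 3 - t 3) ^ 2 +
      (s 4 - t 4) ^ 2 ≤ 0 := by
    simp only [lorInner] at hs ht hpos
    rw [h] at hs hpos
    linarith
  have eq_of_sq {x y : ℤ} (hxy : (x - y) ^ 2 ≤ 0) : x = y :=
    sub_eq_zero.mp (pow_eq_zero_iff two_ne_zero |>.mp (le_antisymm hxy (sq_nonneg _)))
  have h0 := sq_nonneg (s 0 - t 0)
  have h1 := sq_nonneg (s 1 - t 1)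
  have h2 := sq_nonneg (s 2 - t 2)
  have h3 := sq_nonneg (s 3 - t 3)
  have h4 := sq_nonneg (s 4 - t 4)
  ext i
  fin_cases i
  on_goal 6 => exact h
  all_goals exact eq_of_sq (by dsimp; linarith)

lemma mul_le_sq_of_sq_eq_one {x y : ℤ} (hy : y ^ 2 = 1) : x * y ≤ x ^ 2 := by
  rcases sq_eq_sq_iff_eq_or_eq_neg.mp (hy.trans (one_pow 2).symm) with rfl | rfl
  · simpa using Int.le_self_sq x
  · simpa using Int.le_self_sq (-x)

lemma lorInner_nonpos_of_height_one_two {s t : Fin 6 → ℤ} (hs : lorInner s s = 1)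
    (hs5 : s 5 = 1) (ht5 : t 5 = 2) (ht : ∀ i : Fin 5, t i.castSucc ^ 2 = 1) :
    lorInner s t ≤ 0 := by
  have h0 := mul_le_sq_of_sq_eq_one (x := s 0) (ht 0)
  have h1 := mul_le_sq_of_sq_eq_one (x := s 1) (ht 1)
  have h2 := mul_le_sq_of_sq_eq_one (x := s 2) (ht 2)
  have h3 := mul_le_sq_of_sq_eq_one (x := s 3) (ht 3)
  have h4 := mul_le_sq_of_sq_eq_one (x := s 4) (ht 4)
  simp only [lorInner, hs5, ht5] at hs ⊢
  simp only [Fin.castSucc_zero, Fin.reduceCastSucc] at h0 h1 h2 h3 h4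
  linarith

lemma lorInner_comm (s t : Fin 6 → ℤ) : lorInner s t = lorInner t s := by
  simp only [lorInner]
  ring

/-- Each Lorentz normal vector `s` of a side of `Q⁵` satisfies `s∘s = 1`, and for two
distinct normal vectors `s, t` one has `s∘t = 0` or `s∘t ≤ −1`: the polytope `Q⁵` is
right-angled. -/
theorem Q5_right_angled :
    (∀ s ∈ sidesQ5, lorInner s s = 1) ∧
      ∀ s ∈ sidesQ5, ∀ t ∈ sidesQ5, s ≠ t → lorInner s t = 0 ∨ lorInner s t ≤ -1 := by
  refine ⟨fun s => lorInner_self_of_mem_sidesQ5, fun s hs t ht hst => ?_⟩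
  suffices h : lorInner s t ≤ 0 by omega
  have hss := lorInner_self_of_mem_sidesQ5 hs
  have htt := lorInner_self_of_mem_sidesQ5 ht
  rcases height_of_mem_sidesQ5 hs with hs1 | ⟨hs2, hs'⟩ <;>
    rcases height_of_mem_sidesQ5 ht with ht1 | ⟨ht2, ht'⟩
  · exact lorInner_nonpos_of_height_eq hss htt (hs1.trans ht1.symm) hst
  · exact lorInner_nonpos_of_height_one_two hss hs1 ht2 ht'
  · rw [lorInner_comm]
    exact lorInner_nonpos_of_height_one_two htt ht1 hs2 hs'
  · exact lorInner_nonpos_of_height_eq hss htt (hs2.trans ht2.symm) hst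
end
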